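/- arXiv:2603.24444 — 7 statements merged into one kernel-verified Lean document; each statement's English description precedes it below -/
import Mathlib

section
/- Let ε > 0 and m be real. For complex numbers A, B, C, D, the transfer relation (ε·1 + (m/2)·σˣ) · (D, C)ᵀ = (ε·1 − (m/2)·σˣ) · (B, A)ᵀ holds if and only if the scattering relation (B, C)ᵀ = S_D · (D, A)ᵀ holds, where σˣ := !![0, 1; 1, 0], 1 is the 2×2 identity, N := ε² + m²/4, and S_D := N⁻¹ · !![ε² − m²/4, ε·m; −ε·m, ε² − m²/4]. -/
open Matrix

/-- The Pauli-x matrix. -/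
def sigmaX : Matrix (Fin 2) (Fin 2) ℂ := !![0, 1; 1, 0]

theorem stmt_2 (ε m : ℝ) (hε : 0 < ε) (A B C D : ℂ) :
    let N : ℝ := ε ^ 2 + m ^ 2 / 4
    let S_D : Matrix (Fin 2) (Fin 2) ℂ :=
      ((N : ℂ))⁻¹ • !![((ε ^ 2 - m ^ 2 / 4 : ℝ) : ℂ), ((ε * m : ℝ) : ℂ);
          ((-(ε * m) : ℝ) : ℂ), ((ε ^ 2 - m ^ 2 / 4 : ℝ) : ℂ)]
    (((ε : ℂ) • (1 : Matrix (Fin 2) (Fin 2) ℂ) + ((m : ℂ) / 2) • sigmaX) *ᵥ ![D, C] =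
        ((ε : ℂ) • (1 : Matrix (Fin 2) (Fin 2) ℂ) - ((m : ℂ) / 2) • sigmaX) *ᵥ ![B, A]) ↔
      ![B, C] = S_D *ᵥ ![D, A] := by
  intro N S_D
  have hN : (ε : ℂ) ^ 2 + (m : ℂ) ^ 2 / 4 ≠ 0 := by
    exact_mod_cast (by positivity : ε ^ 2 + m ^ 2 / 4 ≠ 0)
  have htransfer : (((ε : ℂ) • (1 : Matrix (Fin 2) (Fin 2) ℂ) + ((m : ℂ) / 2) • sigmaX) *ᵥ ![D, C] =
      ((ε : ℂ) • (1 : Matrix (Fin 2) (Fin 2) ℂ) - ((m : ℂ) / 2) • sigmaX) *ᵥ ![B, A]) ↔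
      ε * D + m / 2 * C = ε * B - m / 2 * A ∧ m / 2 * D + ε * C = ε * A - m / 2 * B := by
    simp [funext_iff, Fin.forall_fin_two, sigmaX]
    ring_nf
  have hscatter : ![B, C] = S_D *ᵥ ![D, A] ↔
      ((ε : ℂ) ^ 2 + (m : ℂ) ^ 2 / 4) * B = (ε ^ 2 - m ^ 2 / 4) * D + ε * m * A ∧
      ((ε : ℂ) ^ 2 + (m : ℂ) ^ 2 / 4) * C = -(ε * m) * D + (ε ^ 2 - m ^ 2 / 4) * A := by
    rw [Matrix.smul_mulVec]
    simp only [N, funext_iff, Fin.forall_fin_two, Pi.smul_apply, smul_eq_mul, Matrix.mulVec,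
      dotProduct, Fin.sum_univ_two, Matrix.of_apply, Matrix.cons_val_zero, Matrix.cons_val_one]
    push_cast
    rw [eq_inv_mul_iff_mul_eq₀ hN, eq_inv_mul_iff_mul_eq₀ hN]
  rw [htransfer, hscatter]
  constructor
  · rintro ⟨h₀, h₁⟩
    constructor
    · linear_combination -(ε : ℂ) * h₀ + (m : ℂ) / 2 * h₁
    · linear_combination (m : ℂ) / 2 * h₀ + (ε : ℂ) * h₁
  · rintro ⟨hB, hC⟩
    constructor
    · apply mul_left_cancel₀ hN
      linear_combination -(ε : ℂ) * hB + (m : ℂ) / 2 * hC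
    · apply mul_left_cancel₀ hN
      linear_combination (m : ℂ) / 2 * hB + (ε : ℂ) * hC
end

section
/- Let ε > 0 and J_x, J_y, J_z be real. Let H_m := !![J_z,0,0,J_x−J_y; 0,−J_z,J_x+J_y,0; 0,J_x+J_y,−J_z,0; J_x−J_y,0,0,J_z] and Σ := diag(1,−1,1,−1) (both 4×4 complex matrices in the basis (L↑, R↑, L↓, R↓)). For vectors ψ₊ = (a₁,a₂,a₃,a₄) and ψ₋ = (b₁,b₂,b₃,b₄) in ℂ⁴, the transfer relation (−iε·Σ + H_m/2) · ψ₊ = (−iε·Σ − H_m/2) · ψ₋ holds if and only if (b₁, a₂, b₃, a₄)ᵀ = S¹ʷ · (a₁, b₂, a₃, b₄)ᵀ, where S¹ʷ := !![α,0,0,β; 0,γ,δ,0; 0,δ,γ,0; β,0,0,α] with d₁ := (2iε + J_z)² − (J_x − J_y)², d₂ := (2iε − J_z)² − (J_x + J_y)², α := −(4ε² − (J_x − J_y)² + J_z²)/d₁, β := −4iε(J_x − J_y)/d₁, γ := −(4ε² − (J_x + J_y)² + J_z²)/d₂, δ := −4iε(J_x + J_y)/d₂. -/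
open Matrix

/-- Cramer's rule for a symmetric two-by-two block with equal diagonal entries. -/
lemma symm_pair_system_iff {m n k x y a b : ℂ} (hd : m ^ 2 - k ^ 2 ≠ 0) :
    (m * x + k * y = n * a - k * b ∧ k * x + m * y = n * b - k * a) ↔
      x = (m * n + k ^ 2) / (m ^ 2 - k ^ 2) * a - k * (m + n) / (m ^ 2 - k ^ 2) * b ∧
      y = (m * n + k ^ 2) / (m ^ 2 - k ^ 2) * b - k * (m + n) / (m ^ 2 - k ^ 2) * a := by
  constructor
  · rintro ⟨h₁, h₂⟩
    constructor
    · field_simp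
      linear_combination m * h₁ - k * h₂
    · field_simp
      linear_combination m * h₂ - k * h₁
  · rintro ⟨rfl, rfl⟩
    constructor <;> · field_simp; ring

lemma sq_sub_sq_ne_zero_of_im {m k : ℂ} (hm : m.im ≠ 0) (hk : k.im = 0) :
    m ^ 2 - k ^ 2 ≠ 0 := by
  intro h
  rcases sq_eq_sq_iff_eq_or_eq_neg.mp (sub_eq_zero.mp h) with rfl | rfl
  · exact hm hk
  · exact hm (by simp [hk])

theorem stmt_4 (ε Jx Jy Jz : ℝ) (hε : 0 < ε) (a₁ a₂ a₃ a₄ b₁ b₂ b₃ b₄ : ℂ) :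
    let Hm : Matrix (Fin 4) (Fin 4) ℂ :=
      !![(Jz : ℂ), 0, 0, (Jx : ℂ) - (Jy : ℂ);
         0, -(Jz : ℂ), (Jx : ℂ) + (Jy : ℂ), 0;
         0, (Jx : ℂ) + (Jy : ℂ), -(Jz : ℂ), 0;
         (Jx : ℂ) - (Jy : ℂ), 0, 0, (Jz : ℂ)]
    let Sig : Matrix (Fin 4) (Fin 4) ℂ := Matrix.diagonal ![1, -1, 1, -1]
    let d₁ : ℂ := (2 * Complex.I * (ε : ℂ) + (Jz : ℂ)) ^ 2 - ((Jx : ℂ) - (Jy : ℂ)) ^ 2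
    let d₂ : ℂ := (2 * Complex.I * (ε : ℂ) - (Jz : ℂ)) ^ 2 - ((Jx : ℂ) + (Jy : ℂ)) ^ 2
    let α : ℂ := -((4 * (ε : ℂ) ^ 2 - ((Jx : ℂ) - (Jy : ℂ)) ^ 2 + (Jz : ℂ) ^ 2) / d₁)
    let β : ℂ := -((4 * Complex.I * (ε : ℂ) * ((Jx : ℂ) - (Jy : ℂ))) / d₁)
    let γ : ℂ := -((4 * (ε : ℂ) ^ 2 - ((Jx : ℂ) + (Jy : ℂ)) ^ 2 + (Jz : ℂ) ^ 2) / d₂)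
    let δ : ℂ := -((4 * Complex.I * (ε : ℂ) * ((Jx : ℂ) + (Jy : ℂ))) / d₂)
    let S : Matrix (Fin 4) (Fin 4) ℂ :=
      !![α, 0, 0, β; 0, γ, δ, 0; 0, δ, γ, 0; β, 0, 0, α]
    (((-(Complex.I * (ε : ℂ))) • Sig + (1 / 2 : ℂ) • Hm) *ᵥ ![a₁, a₂, a₃, a₄] =
        ((-(Complex.I * (ε : ℂ))) • Sig - (1 / 2 : ℂ) • Hm) *ᵥ ![b₁, b₂, b₃, b₄]) ↔
      ![b₁, a₂, b₃, a₄] = S *ᵥ ![a₁, b₂, a₃, b₄] := by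
  intro Hm Sig d₁ d₂ α β γ δ S
  have hd₁ : d₁ ≠ 0 := sq_sub_sq_ne_zero_of_im (by simp [hε.ne']) (by simp)
  have hd₂ : d₂ ≠ 0 := sq_sub_sq_ne_zero_of_im (by simp [hε.ne']) (by simp)
  have outer := symm_pair_system_iff (n := 2 * Complex.I * ε - Jz) (x := b₁) (y := a₄)
    (a := a₁) (b := b₄) hd₁
  have inner := symm_pair_system_iff (n := 2 * Complex.I * ε + Jz) (x := a₂) (y := b₃)
    (a := b₂) (b := a₃) hd₂
  have hα : α = ((2 * Complex.I * ε + Jz) * (2 * Complex.I * ε - Jz) + (Jx - Jy) ^ 2) / d₁ := by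
    simp only [α, ← neg_div]
    congr 1
    linear_combination -4 * (ε : ℂ) ^ 2 * Complex.I_sq
  have hβ : β = -((Jx - Jy) * ((2 * Complex.I * ε + Jz) + (2 * Complex.I * ε - Jz)) / d₁) := by
    simp only [β]
    congr 2
    ring
  have hγ : γ = ((2 * Complex.I * ε - Jz) * (2 * Complex.I * ε + Jz) + (Jx + Jy) ^ 2) / d₂ := by
    simp only [γ, ← neg_div]
    congr 1
    linear_combination -4 * (ε : ℂ) ^ 2 * Complex.I_sq
  have hδ : δ = -((Jx + Jy) * ((2 * Complex.I * ε - Jz) + (2 * Complex.I * ε + Jz)) / d₂) := by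
    simp only [δ]
    congr 2
    ring
  change _ ↔ _ = _ / d₁ * _ - _ / d₁ * _ ∧ _ = _ / d₁ * _ - _ / d₁ * _ at outer
  change _ ↔ _ = _ / d₂ * _ - _ / d₂ * _ ∧ _ = _ / d₂ * _ - _ / d₂ * _ at inner
  have transfer : (((-(Complex.I * (ε : ℂ))) • Sig + (1 / 2 : ℂ) • Hm) *ᵥ ![a₁, a₂, a₃, a₄] =
        ((-(Complex.I * (ε : ℂ))) • Sig - (1 / 2 : ℂ) • Hm) *ᵥ ![b₁, b₂, b₃, b₄]) ↔
      (((2 * Complex.I * ε + Jz) * b₁ + (Jx - Jy) * a₄ =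
          (2 * Complex.I * ε - Jz) * a₁ - (Jx - Jy) * b₄ ∧
        (Jx - Jy) * b₁ + (2 * Complex.I * ε + Jz) * a₄ =
          (2 * Complex.I * ε - Jz) * b₄ - (Jx - Jy) * a₁) ∧
      ((2 * Complex.I * ε - Jz) * a₂ + (Jx + Jy) * b₃ =
          (2 * Complex.I * ε + Jz) * b₂ - (Jx + Jy) * a₃ ∧
        (Jx + Jy) * a₂ + (2 * Complex.I * ε - Jz) * b₃ =
          (2 * Complex.I * ε + Jz) * a₃ - (Jx + Jy) * b₂)) := by
    simp only [Hm, Sig, funext_iff, Fin.forall_fin_succ, Matrix.mulVec, dotProduct,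
      Fin.sum_univ_succ, Matrix.diagonal]
    simp
    constructor
    · rintro ⟨h₁, h₂, h₃, h₄⟩
      refine ⟨⟨?_, ?_⟩, ?_, ?_⟩
      · linear_combination 2 * h₁
      · linear_combination 2 * h₄
      · linear_combination 2 * h₂
      · linear_combination 2 * h₃
    · rintro ⟨⟨h₁, h₄⟩, h₂, h₃⟩
      refine ⟨?_, ?_, ?_, ?_⟩
      · linear_combination h₁ / 2
      · linear_combination h₂ / 2
      · linear_combination h₃ / 2
      · linear_combination h₄ / 2
  have scattering : ![b₁, a₂, b₃, a₄] = S *ᵥ ![a₁, b₂, a₃, b₄] ↔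
      (b₁ = α * a₁ + β * b₄ ∧ a₄ = α * b₄ + β * a₁) ∧
        (a₂ = γ * b₂ + δ * a₃ ∧ b₃ = γ * a₃ + δ * b₂) := by
    simp [S, funext_iff, Fin.forall_fin_succ]
    rw [add_comm (a₁ * β), add_comm (b₂ * δ)]
    simp only [mul_comm]
    tauto
  rw [transfer, scattering, outer, inner, hα, hβ, hγ, hδ]
  simp only [neg_mul, ← sub_eq_add_neg]
end

section
/- Let λ, φ be real with cos φ ≠ 0 and cos²λ ≥ cos²φ. Set D := cos²λ − cos²φ, √D its nonnegative real square root, ζ⁺ := (cos λ + √D)/cos φ, ζ⁻ := (cos λ − √D)/cos φ, and define the 4×4 complex transfer matrix T := (1/cos φ) · !![e^{−iλ}, −sin φ, 0, 0; −sin φ, e^{iλ}, 0, 0; 0, 0, e^{−iλ}, −sin φ; 0, 0, −sin φ, e^{iλ}]. Define v₁^± := (sin φ, −i·sin λ ∓ √D, 0, 0)ᵀ and v₂^± := (0, 0, sin φ, −i·sin λ ∓ √D)ᵀ in ℂ⁴. Then T · v₁⁺ = ζ⁺ · v₁⁺, T · v₁⁻ = ζ⁻ · v₁⁻, T · v₂⁺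 = ζ⁺ · v₂⁺, and T · v₂⁻ = ζ⁻ · v₂⁻. -/
open Matrix

/-- The two scalar eigenvector equations of the block `!![e^{-iλ}, -s; -s, e^{iλ}]`, for either
choice `r` of a square root of `cos² λ - k²`, where `k² + s² = 1`. -/
lemma transfer_block_eigen {l k s r : ℂ} (hk : k ≠ 0) (hks : s ^ 2 + k ^ 2 = 1)
    (hr : r ^ 2 = Complex.cos l ^ 2 - k ^ 2) :
    k⁻¹ * Complex.exp (-(Complex.I * l)) * s + k⁻¹ * -s * (-Complex.I * Complex.sin l - r) =
        (Complex.cos l + r) / k * s ∧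
      k⁻¹ * -s * s + k⁻¹ * Complex.exp (Complex.I * l) * (-Complex.I * Complex.sin l - r) =
        (Complex.cos l + r) / k * (-Complex.I * Complex.sin l - r) := by
  have hneg : Complex.exp (-(Complex.I * l)) = Complex.cos l - Complex.sin l * Complex.I := by
    rw [mul_comm, ← neg_mul, Complex.exp_mul_I, Complex.cos_neg, Complex.sin_neg]
    ring
  have hpos : Complex.exp (Complex.I * l) = Complex.cos l + Complex.sin l * Complex.I := by
    rw [mul_comm, Complex.exp_mul_I]
  rw [hneg, hpos]
  constructor
  · field_simp
    ring
  · field_simp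
    linear_combination hr - hks + Complex.sin_sq_add_cos_sq l -
      Complex.sin l ^ 2 * Complex.I_sq

/-- The transfer matrix maps the vectors supported on either block to multiples of themselves. -/
lemma transfer_matrix_eigen {l k s r : ℂ} (hk : k ≠ 0) (hks : s ^ 2 + k ^ 2 = 1)
    (hr : r ^ 2 = Complex.cos l ^ 2 - k ^ 2) (a b : ℂ) :
    (k⁻¹ • !![Complex.exp (-(Complex.I * l)), -s, 0, 0;
              -s, Complex.exp (Complex.I * l), 0, 0;
              0, 0, Complex.exp (-(Complex.I * l)), -s;
              0, 0, -s, Complex.exp (Complex.I * l)]) *ᵥ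
        ![a * s, a * (-Complex.I * Complex.sin l - r),
          b * s, b * (-Complex.I * Complex.sin l - r)] =
      ((Complex.cos l + r) / k) •
        ![a * s, a * (-Complex.I * Complex.sin l - r),
          b * s, b * (-Complex.I * Complex.sin l - r)] := by
  obtain ⟨h₁, h₂⟩ := transfer_block_eigen hk hks hr
  ext i
  fin_cases i <;> simp [mulVec, dotProduct, Fin.sum_univ_four, -neg_mul, -mul_neg]
  · linear_combination a * h₁
  · linear_combination a * h₂
  · linear_combination b * h₁
  · linear_combination b * h₂

theorem stmt_10 (lam φ : ℝ) (hφ : Real.cos φ ≠ 0)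
    (h : Real.cos φ ^ 2 ≤ Real.cos lam ^ 2) :
    let D : ℝ := Real.cos lam ^ 2 - Real.cos φ ^ 2
    let ζp : ℂ := ((Real.cos lam + Real.sqrt D) / Real.cos φ : ℝ)
    let ζm : ℂ := ((Real.cos lam - Real.sqrt D) / Real.cos φ : ℝ)
    let T : Matrix (Fin 4) (Fin 4) ℂ :=
      ((Real.cos φ : ℂ))⁻¹ •
        !![Complex.exp (-(Complex.I * (lam : ℂ))), -(Real.sin φ : ℂ), 0, 0;
           -(Real.sin φ : ℂ), Complex.exp (Complex.I * (lam : ℂ)), 0, 0;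
           0, 0, Complex.exp (-(Complex.I * (lam : ℂ))), -(Real.sin φ : ℂ);
           0, 0, -(Real.sin φ : ℂ), Complex.exp (Complex.I * (lam : ℂ))]
    let v₁p : Fin 4 → ℂ :=
      ![(Real.sin φ : ℂ), -Complex.I * (Real.sin lam : ℂ) - (Real.sqrt D : ℂ), 0, 0]
    let v₁m : Fin 4 → ℂ :=
      ![(Real.sin φ : ℂ), -Complex.I * (Real.sin lam : ℂ) + (Real.sqrt D : ℂ), 0, 0]
    let v₂p : Fin 4 → ℂ :=
      ![0, 0, (Real.sin φ : ℂ), -Complex.I * (Real.sin lam : ℂ) - (Real.sqrt D : ℂ)]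
    let v₂m : Fin 4 → ℂ :=
      ![0, 0, (Real.sin φ : ℂ), -Complex.I * (Real.sin lam : ℂ) + (Real.sqrt D : ℂ)]
    T *ᵥ v₁p = ζp • v₁p ∧ T *ᵥ v₁m = ζm • v₁m ∧
    T *ᵥ v₂p = ζp • v₂p ∧ T *ᵥ v₂m = ζm • v₂m := by
  intro D ζp ζm T v₁p v₁m v₂p v₂m
  have hk : (Real.cos φ : ℂ) ≠ 0 := by exact_mod_cast hφ
  have hks : (Real.sin φ : ℂ) ^ 2 + (Real.cos φ : ℂ) ^ 2 = 1 := by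
    exact_mod_cast Real.sin_sq_add_cos_sq φ
  have hr : (Real.sqrt D : ℂ) ^ 2 = Complex.cos lam ^ 2 - (Real.cos φ : ℂ) ^ 2 := by
    rw [← Complex.ofReal_cos]
    exact_mod_cast Real.sq_sqrt (sub_nonneg.mpr h)
  have hr' : (-(Real.sqrt D : ℂ)) ^ 2 = Complex.cos lam ^ 2 - (Real.cos φ : ℂ) ^ 2 := by
    rw [neg_sq, hr]
  have hp := transfer_matrix_eigen hk hks hr
  have hm := transfer_matrix_eigen hk hks hr'
  rw [← Complex.ofReal_cos, ← Complex.ofReal_sin] at hp hm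
  have hζp : ζp = ((Real.cos lam : ℂ) + (Real.sqrt D : ℂ)) / (Real.cos φ : ℂ) := by
    simp only [ζp, Complex.ofReal_div, Complex.ofReal_add]
  have hζm : ζm = ((Real.cos lam : ℂ) + -(Real.sqrt D : ℂ)) / (Real.cos φ : ℂ) := by
    simp only [ζm, Complex.ofReal_div, sub_eq_add_neg, Complex.ofReal_add, Complex.ofReal_neg]
  rw [hζp, hζm]
  refine ⟨?_, ?_, ?_, ?_⟩
  · simpa only [one_mul, zero_mul] using hp 1 0
  · simpa only [one_mul, zero_mul, sub_neg_eq_add] using hm 1 0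
  · simpa only [one_mul, zero_mul] using hp 0 1
  · simpa only [one_mul, zero_mul, sub_neg_eq_add] using hm 0 1
end

section
/- Let λ, φ be real with cos φ ≠ 0, and let T := (1/cos φ) · !![e^{−iλ}, −sin φ, 0, 0; −sin φ, e^{iλ}, 0, 0; 0, 0, e^{−iλ}, −sin φ; 0, 0, −sin φ, e^{iλ}] be the 4×4 complex transfer matrix. Then the characteristic polynomial of T equals (X² − (2·cos λ/cos φ)·X + 1)². In particular, the two distinct roots ζ⁺ and ζ⁻ of X² − (2·cos λ/cos φ)·X + 1 (each an eigenvalue of T with algebraic multiplicity two, when they are distinct) satisfy ζ⁺ · ζ⁻ = 1. -/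
open Matrix Polynomial

theorem charpoly_two_equal_blocks {R : Type*} [CommRing R] (a b c d : R) :
    (!![a, b, 0, 0; c, d, 0, 0; 0, 0, a, b; 0, 0, c, d] : Matrix (Fin 4) (Fin 4) R).charpoly =
      (X ^ 2 - C (a + d) * X + C (a * d - b * c)) ^ 2 := by
  have hchar : charmatrix (!![a, b, 0, 0; c, d, 0, 0; 0, 0, a, b; 0, 0, c, d]) =
      !![X - C a, -C b, 0, 0; -C c, X - C d, 0, 0; 0, 0, X - C a, -C b; 0, 0, -C c, X - C d] := by
    ext1 i j
    fin_cases i <;> fin_cases j <;> simp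
  rw [Matrix.charpoly, hchar]
  simp [Matrix.det_succ_row_zero, Fin.sum_univ_succ, Fin.succAbove]
  ring

theorem mul_eq_one_of_ne_of_quadratic_roots {K : Type*} [Field K] {t x y : K}
    (hx : x ^ 2 - t * x + 1 = 0) (hy : y ^ 2 - t * y + 1 = 0) (hne : x ≠ y) : x * y = 1 := by
  have hsum : x + y = t := by
    apply mul_left_cancel₀ (sub_ne_zero.mpr hne)
    linear_combination hx - hy
  linear_combination x * hsum - hx

theorem stmt_11 (lam φ : ℝ) (hφ : Real.cos φ ≠ 0) :
    let T : Matrix (Fin 4) (Fin 4) ℂ :=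
      ((Real.cos φ : ℂ))⁻¹ •
        !![Complex.exp (-(Complex.I * (lam : ℂ))), -(Real.sin φ : ℂ), 0, 0;
           -(Real.sin φ : ℂ), Complex.exp (Complex.I * (lam : ℂ)), 0, 0;
           0, 0, Complex.exp (-(Complex.I * (lam : ℂ))), -(Real.sin φ : ℂ);
           0, 0, -(Real.sin φ : ℂ), Complex.exp (Complex.I * (lam : ℂ))]
    T.charpoly =
      (X ^ 2 - C ((2 * Real.cos lam / Real.cos φ : ℝ) : ℂ) * X + 1) ^ 2 ∧
    ∀ ζ₁ ζ₂ : ℂ,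
      ζ₁ ^ 2 - ((2 * Real.cos lam / Real.cos φ : ℝ) : ℂ) * ζ₁ + 1 = 0 →
      ζ₂ ^ 2 - ((2 * Real.cos lam / Real.cos φ : ℝ) : ℂ) * ζ₂ + 1 = 0 →
      ζ₁ ≠ ζ₂ → ζ₁ * ζ₂ = 1 := by
  intro T
  refine ⟨?_, fun ζ₁ ζ₂ h₁ h₂ hne => mul_eq_one_of_ne_of_quadratic_roots h₁ h₂ hne⟩
  have hc : (Real.cos φ : ℂ) ≠ 0 := Complex.ofReal_ne_zero.mpr hφ
  have hT : T = !![
      (Real.cos φ : ℂ)⁻¹ * Complex.exp (-(Complex.I * lam)),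
        (Real.cos φ : ℂ)⁻¹ * -(Real.sin φ : ℂ), 0, 0;
      (Real.cos φ : ℂ)⁻¹ * -(Real.sin φ : ℂ),
        (Real.cos φ : ℂ)⁻¹ * Complex.exp (Complex.I * lam), 0, 0;
      0, 0, (Real.cos φ : ℂ)⁻¹ * Complex.exp (-(Complex.I * lam)),
        (Real.cos φ : ℂ)⁻¹ * -(Real.sin φ : ℂ);
      0, 0, (Real.cos φ : ℂ)⁻¹ * -(Real.sin φ : ℂ),
        (Real.cos φ : ℂ)⁻¹ * Complex.exp (Complex.I * lam)] := by
    simp [T, Matrix.smul_of]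
  rw [hT, charpoly_two_equal_blocks]
  have htrace : (Real.cos φ : ℂ)⁻¹ * Complex.exp (-(Complex.I * lam)) +
      (Real.cos φ : ℂ)⁻¹ * Complex.exp (Complex.I * lam) =
      ((2 * Real.cos lam / Real.cos φ : ℝ) : ℂ) := by
    have h := Complex.two_cos (lam : ℂ)
    rw [mul_comm (lam : ℂ), neg_mul, mul_comm (lam : ℂ)] at h
    push_cast at hc ⊢
    rw [h]
    field_simp
    ring
  have hdet : (Real.cos φ : ℂ)⁻¹ * Complex.exp (-(Complex.I * lam)) *
      ((Real.cos φ : ℂ)⁻¹ * Complex.exp (Complex.I * lam)) -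
      (Real.cos φ : ℂ)⁻¹ * -(Real.sin φ : ℂ) * ((Real.cos φ : ℂ)⁻¹ * -(Real.sin φ : ℂ)) = 1 := by
    have hexp : Complex.exp (-(Complex.I * lam)) * Complex.exp (Complex.I * lam) = 1 := by
      rw [← Complex.exp_add, neg_add_cancel, Complex.exp_zero]
    have hsc : (Real.sin φ : ℂ) ^ 2 + (Real.cos φ : ℂ) ^ 2 = 1 := by
      exact_mod_cast Real.sin_sq_add_cos_sq φ
    have hinv : (Real.cos φ : ℂ)⁻¹ * (Real.cos φ : ℂ) = 1 := inv_mul_cancel₀ hc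
    linear_combination (Real.cos φ : ℂ)⁻¹ ^ 2 * hexp - (Real.cos φ : ℂ)⁻¹ ^ 2 * hsc +
      ((Real.cos φ : ℂ)⁻¹ * (Real.cos φ : ℂ) + 1) * hinv
  rw [htrace, hdet, C_1]
end

section
/- Let λ, φ, J be real with cos²λ ≥ cos²φ and 1 − 2J² + cos 2φ ≠ 0. Set D := cos²λ − cos²φ with nonnegative real square root √D, define v₁⁺ := (sin φ, −i·sin λ − √D, 0, 0)ᵀ and v₂⁺ := (0, 0, sin φ, −i·sin λ − √D)ᵀ in ℂ⁴, and define the 4×4 complex matrix T₀ := (1 − 2J² + cos 2φ)⁻¹ · !![2e^{−iλ}(−J² + cos φ), −sin 2φ, 2i·e^{−iλ}·J·sin φ, 2iJ(−1 + cos φ); −sin 2φ, 2e^{iλ}(J² + cos φ), −2iJ(1 + cos φ), 2i·e^{iλ}·J·sin φ; −2i·e^{−iλ}·J·sin φ, 2iJ(1 + cos φ), 2e^{−iλ}(J² + cos φ), −sin 2φ; −2iJ(−1 + cos φ), −2i·e^{iλ}·J·sin φ, −sin 2φ, 2e^{iλ}(−J² + cos φ)]. Then, with ⬝ the non-conjugated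 bilinear dot product on ℂ⁴: v₁⁺ ⬝ (T₀ · v₂⁺) = − v₂⁺ ⬝ (T₀ · v₁⁺). -/
open Matrix

theorem stmt_17 (lam φ J : ℝ) (h : Real.cos φ ^ 2 ≤ Real.cos lam ^ 2)
    (hJ : 1 - 2 * J ^ 2 + Real.cos (2 * φ) ≠ 0) :
    let D : ℝ := Real.cos lam ^ 2 - Real.cos φ ^ 2
    let v₁p : Fin 4 → ℂ :=
      ![(Real.sin φ : ℂ), -Complex.I * (Real.sin lam : ℂ) - (Real.sqrt D : ℂ), 0, 0]
    let v₂p : Fin 4 → ℂ :=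
      ![0, 0, (Real.sin φ : ℂ), -Complex.I * (Real.sin lam : ℂ) - (Real.sqrt D : ℂ)]
    let eP : ℂ := Complex.exp (Complex.I * (lam : ℂ))
    let eM : ℂ := Complex.exp (-(Complex.I * (lam : ℂ)))
    let T₀ : Matrix (Fin 4) (Fin 4) ℂ :=
      (((1 - 2 * J ^ 2 + Real.cos (2 * φ) : ℝ) : ℂ))⁻¹ •
        !![2 * eM * (-(J : ℂ) ^ 2 + (Real.cos φ : ℂ)), -(Real.sin (2 * φ) : ℂ),
             2 * Complex.I * eM * (J : ℂ) * (Real.sin φ : ℂ),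
             2 * Complex.I * (J : ℂ) * (-1 + (Real.cos φ : ℂ));
           -(Real.sin (2 * φ) : ℂ), 2 * eP * ((J : ℂ) ^ 2 + (Real.cos φ : ℂ)),
             -(2 * Complex.I * (J : ℂ) * (1 + (Real.cos φ : ℂ))),
             2 * Complex.I * eP * (J : ℂ) * (Real.sin φ : ℂ);
           -(2 * Complex.I * eM * (J : ℂ) * (Real.sin φ : ℂ)),
             2 * Complex.I * (J : ℂ) * (1 + (Real.cos φ : ℂ)),
             2 * eM * ((J : ℂ) ^ 2 + (Real.cos φ : ℂ)), -(Real.sin (2 * φ) : ℂ);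
           -(2 * Complex.I * (J : ℂ) * (-1 + (Real.cos φ : ℂ))),
             -(2 * Complex.I * eP * (J : ℂ) * (Real.sin φ : ℂ)),
             -(Real.sin (2 * φ) : ℂ), 2 * eP * (-(J : ℂ) ^ 2 + (Real.cos φ : ℂ))]
    v₁p ⬝ᵥ (T₀ *ᵥ v₂p) = -(v₂p ⬝ᵥ (T₀ *ᵥ v₁p)) := by
  intro D v₁p v₂p eP eM T₀
  simp [v₁p, v₂p, T₀, dotProduct, mulVec, Fin.sum_univ_four]
  ring
end

section
/- Let ε > 0 and J_x, J_y, J_z be real, and set J₊ := J_x + J_y, J₋ := J_x − J_y, D := −2i·J_x·J_y·J_z + (J_x² + J_y² + J_z²)·ε + ε³. Let M̃ be the 8×8 real symmetric matrix (in the basis (LL↑, RL↑, LR↑, RR↑, LL↓, RL↓, LR↓, RR↓)) whose nonzero entries are: M̃₁₁ = 2J_z, M̃₄₄ = −2J_z, M̃₅₅ = −2J_z, M̃₈₈ = 2J_z; M̃₁₆ = M̃₁₇ = M̃₆₁ = M̃₇₁ = J₋, M̃₂₈ = M̃₃₈ = M̃₈₂ = M̃₈₃ = J₋; M̃₂₅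 = M̃₃₅ = M̃₅₂ = M̃₅₃ = J₊, M̃₄₆ = M̃₄₇ = M̃₆₄ = M̃₇₄ = J₊. Define α₊ := (2i·J_x·J_y·J_z − J_z²ε + ε³ + 2i·J_z·ε² + 2J_x·J_y·ε)/D, α₋ := (2i·J_x·J_y·J_z − J_z²ε + ε³ − 2i·J_z·ε² − 2J_x·J_y·ε)/D, β := (−J_x² + J_y²)·ε/D, γ := (J_z²ε + ε³)/D, δ := (2i·J_x·J_y·J_z − (J_x² + J_y²)·ε)/D, ε₊ := (J_x + J_y)(J_z + iε)ε/D, ε₋ := −(J_x − J_y)(J_z − iε)ε/D, and let S²ʷ be the 8×8 complex matrix with α₊ at positions (1,1),(8,8); α₋ at (4,4),(5,5); β at (1,4),(4,1),(5,8),(8,5); γ at (2,2),(3,3),(6,6),(7,7); δ at (2,3),(3,2),(6,7),(7,6); ε₋ at (1,6),(1,7),(2,8),(3,8),(6,1),(7,1),(8,2),(8,3); ε₊ at (2,5),(3,5),(4,6),(4,7),(5,2),(5,3),(6,4),(7,4); and zero elsewhere. Then D ≠ 0, (iε·1 + M̃/2) · S²ʷ = iε·1 − M̃/2, and S²ʷ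 is unitary. -/
open Matrix

/-- The Cayley transform of a Hermitian matrix is unitary. -/
theorem conjTranspose_mul_self_of_cayley {n : Type*} [Fintype n] [DecidableEq n] {c : ℂ}
    (hc : c ≠ 0) (hc' : star c = -c) {H S : Matrix n n ℂ} (hH : H.IsHermitian)
    (hS : (c • (1 : Matrix n n ℂ) + H) * S = c • (1 : Matrix n n ℂ) - H) : Sᴴ * S = 1 := by
  have h : (c • (1 : Matrix n n ℂ) + H) * (S + 1) = (2 * c) • (1 : Matrix n n ℂ) := by
    rw [mul_add, hS, mul_one]
    module
  have h' : (S + 1)ᴴ * (-(c • (1 : Matrix n n ℂ)) + H) = -((2 * c) • (1 : Matrix n n ℂ)) := by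
    have := congrArg conjTranspose h
    simpa [conjTranspose_mul, conjTranspose_smul, hc', hH.eq] using this
  have key : (2 * c) • ((S + 1)ᴴ * (S + 1)) = (2 * c) • ((S + 1)ᴴ + (S + 1)) := by
    calc (2 * c) • ((S + 1)ᴴ * (S + 1))
        = (S + 1)ᴴ * ((c • (1 : Matrix n n ℂ) + H) * (S + 1))
          - ((S + 1)ᴴ * (-(c • (1 : Matrix n n ℂ)) + H)) * (S + 1) := by
          rw [Matrix.mul_assoc, ← Matrix.mul_sub, ← Matrix.sub_mul,
            show c • (1 : Matrix n n ℂ) + H - (-(c • (1 : Matrix n n ℂ)) + H)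
              = (2 * c) • (1 : Matrix n n ℂ) by module]
          simp [mul_add]
      _ = _ := by
          rw [h, h']
          simp only [mul_smul_comm, mul_one, neg_mul, smul_mul_assoc, one_mul]
          module
  have key' := smul_right_injective _ (mul_ne_zero two_ne_zero hc) key
  simp only [conjTranspose_add, conjTranspose_one, add_mul, mul_add, mul_one, one_mul] at key'
  calc Sᴴ * S = (Sᴴ * S + S + (Sᴴ + 1)) - (S + Sᴴ + 1) := by abel
    _ = (Sᴴ + 1 + (S + 1)) - (S + Sᴴ + 1) := by rw [key']
    _ = 1 := by abel

/-- The two-walker interaction matrix, with `p = Jx + Jy` and `m = Jx - Jy`. -/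
def interactionMatrix (z p m : ℂ) : Matrix (Fin 8) (Fin 8) ℂ :=
  !![2 * z, 0, 0, 0, 0, m, m, 0;
     0, 0, 0, 0, p, 0, 0, m;
     0, 0, 0, 0, p, 0, 0, m;
     0, 0, 0, -(2 * z), 0, p, p, 0;
     0, p, p, 0, -(2 * z), 0, 0, 0;
     m, 0, 0, p, 0, 0, 0, 0;
     m, 0, 0, p, 0, 0, 0, 0;
     0, m, m, 0, 0, 0, 0, 2 * z]

/-- The two-walker scattering matrix as a function of its seven distinct entries. -/
def scatteringMatrix (αp αm β γ δ εp εm : ℂ) : Matrix (Fin 8) (Fin 8) ℂ :=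
  !![αp, 0, 0, β, 0, εm, εm, 0;
     0, γ, δ, 0, εp, 0, 0, εm;
     0, δ, γ, 0, εp, 0, 0, εm;
     β, 0, 0, αm, 0, εp, εp, 0;
     0, εp, εp, 0, αm, 0, 0, β;
     εm, 0, 0, εp, 0, γ, δ, 0;
     εm, 0, 0, εp, 0, δ, γ, 0;
     0, εm, εm, 0, β, 0, 0, αp]

theorem interactionMatrix_isHermitian (x y z : ℝ) :
    (interactionMatrix z (x + y) (x - y)).IsHermitian := by
  ext i j
  fin_cases i <;> fin_cases j <;> simp [interactionMatrix]

set_option maxHeartbeats 1000000 in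
/-- The scattering equation follows from its ten distinct scalar entries; `hij` is the entry in
row `i` and column `j`, counted from one. -/
theorem add_interactionMatrix_mul_scatteringMatrix {e z p m αp αm β γ δ εp εm : ℂ}
    (h11 : (e + z) * αp + m * εm = e - z)
    (h14 : (e + z) * β + m * εp = 0)
    (h16 : (e + z) * εm + m / 2 * (γ + δ) = -(m / 2))
    (h22 : e * γ + p / 2 * εp + m / 2 * εm = e)
    (h23 : e * δ + p / 2 * εp + m / 2 * εm = 0)
    (h25 : e * εp + p / 2 * αm + m / 2 * β = -(p / 2))
    (h28 : e * εm + p / 2 * β + m / 2 * αp = -(m / 2))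
    (h41 : (e - z) * β + p * εm = 0)
    (h44 : (e - z) * αm + p * εp = e + z)
    (h46 : (e - z) * εp + p / 2 * (γ + δ) = -(p / 2)) :
    (e • (1 : Matrix (Fin 8) (Fin 8) ℂ) + (1 / 2 : ℂ) • interactionMatrix z p m) *
        scatteringMatrix αp αm β γ δ εp εm =
      e • (1 : Matrix (Fin 8) (Fin 8) ℂ) - (1 / 2 : ℂ) • interactionMatrix z p m := by
  ext i j
  fin_cases i <;> fin_cases j <;>
    simp [interactionMatrix, scatteringMatrix, Matrix.mul_apply, Fin.sum_univ_succ,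
      Matrix.one_apply] <;> grind

theorem stmt_18 (ε Jx Jy Jz : ℝ) (hε : 0 < ε) :
    let Jp : ℂ := (Jx : ℂ) + (Jy : ℂ)
    let Jm : ℂ := (Jx : ℂ) - (Jy : ℂ)
    let D : ℂ := -(2 * Complex.I * (Jx : ℂ) * (Jy : ℂ) * (Jz : ℂ)) +
      ((Jx : ℂ) ^ 2 + (Jy : ℂ) ^ 2 + (Jz : ℂ) ^ 2) * (ε : ℂ) + (ε : ℂ) ^ 3
    let M : Matrix (Fin 8) (Fin 8) ℂ :=
      !![2 * (Jz : ℂ), 0, 0, 0, 0, Jm, Jm, 0;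
         0, 0, 0, 0, Jp, 0, 0, Jm;
         0, 0, 0, 0, Jp, 0, 0, Jm;
         0, 0, 0, -(2 * (Jz : ℂ)), 0, Jp, Jp, 0;
         0, Jp, Jp, 0, -(2 * (Jz : ℂ)), 0, 0, 0;
         Jm, 0, 0, Jp, 0, 0, 0, 0;
         Jm, 0, 0, Jp, 0, 0, 0, 0;
         0, Jm, Jm, 0, 0, 0, 0, 2 * (Jz : ℂ)]
    let αp : ℂ := (2 * Complex.I * (Jx : ℂ) * (Jy : ℂ) * (Jz : ℂ) - (Jz : ℂ) ^ 2 * (ε : ℂ) +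
      (ε : ℂ) ^ 3 + (2 * Complex.I * (Jz : ℂ) * (ε : ℂ) ^ 2 + 2 * (Jx : ℂ) * (Jy : ℂ) * (ε : ℂ))) / D
    let αm : ℂ := (2 * Complex.I * (Jx : ℂ) * (Jy : ℂ) * (Jz : ℂ) - (Jz : ℂ) ^ 2 * (ε : ℂ) +
      (ε : ℂ) ^ 3 - (2 * Complex.I * (Jz : ℂ) * (ε : ℂ) ^ 2 + 2 * (Jx : ℂ) * (Jy : ℂ) * (ε : ℂ))) / D
    let β : ℂ := ((-(Jx : ℂ) ^ 2 + (Jy : ℂ) ^ 2) * (ε : ℂ)) / D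
    let γ : ℂ := ((Jz : ℂ) ^ 2 * (ε : ℂ) + (ε : ℂ) ^ 3) / D
    let δ : ℂ := (2 * Complex.I * (Jx : ℂ) * (Jy : ℂ) * (Jz : ℂ) -
      ((Jx : ℂ) ^ 2 + (Jy : ℂ) ^ 2) * (ε : ℂ)) / D
    let εp : ℂ := (((Jx : ℂ) + (Jy : ℂ)) * ((Jz : ℂ) + Complex.I * (ε : ℂ)) * (ε : ℂ)) / D
    let εm : ℂ := -((((Jx : ℂ) - (Jy : ℂ)) * ((Jz : ℂ) - Complex.I * (ε : ℂ)) * (ε : ℂ)) / D)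
    let S : Matrix (Fin 8) (Fin 8) ℂ :=
      !![αp, 0, 0, β, 0, εm, εm, 0;
         0, γ, δ, 0, εp, 0, 0, εm;
         0, δ, γ, 0, εp, 0, 0, εm;
         β, 0, 0, αm, 0, εp, εp, 0;
         0, εp, εp, 0, αm, 0, 0, β;
         εm, 0, 0, εp, 0, γ, δ, 0;
         εm, 0, 0, εp, 0, δ, γ, 0;
         0, εm, εm, 0, β, 0, 0, αp]
    D ≠ 0 ∧
    ((Complex.I * (ε : ℂ)) • (1 : Matrix (Fin 8) (Fin 8) ℂ) + (1 / 2 : ℂ) • M) * S =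
      (Complex.I * (ε : ℂ)) • (1 : Matrix (Fin 8) (Fin 8) ℂ) - (1 / 2 : ℂ) • M ∧
    Sᴴ * S = 1 ∧ S * Sᴴ = 1 := by
  intro Jp Jm D M αp αm β γ δ εp εm S
  have hD : D ≠ 0 := by
    intro h
    have hre := congrArg Complex.re h
    simp [D, pow_succ] at hre
    nlinarith [mul_pos hε (pow_pos hε 2), mul_nonneg hε.le (sq_nonneg Jx),
      mul_nonneg hε.le (sq_nonneg Jy), mul_nonneg hε.le (sq_nonneg Jz)]
  have h11 : (Complex.I * (ε : ℂ) + (Jz : ℂ)) * αp + Jm * εm = Complex.I * (ε : ℂ) - (Jz : ℂ) := by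
    simp only [αp, εm, Jm]
    field_simp
    simp only [D]
    clear * -
    grind [Complex.I_sq]
  have h14 : (Complex.I * (ε : ℂ) + (Jz : ℂ)) * β + Jm * εp = 0 := by
    simp only [β, εp, Jm]
    field_simp
    simp only [D]
    clear * -
    grind [Complex.I_sq]
  have h16 : (Complex.I * (ε : ℂ) + (Jz : ℂ)) * εm + Jm / 2 * (γ + δ) = -(Jm / 2) := by
    simp only [γ, δ, εm, Jm]
    field_simp
    simp only [D]
    clear * -
    grind [Complex.I_sq]
  have h22 : Complex.I * (ε : ℂ) * γ + Jp / 2 * εp + Jm / 2 * εm = Complex.I * (ε : ℂ) := by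
    simp only [γ, εp, εm, Jp, Jm]
    field_simp
    simp only [D]
    clear * -
    grind [Complex.I_sq]
  have h23 : Complex.I * (ε : ℂ) * δ + Jp / 2 * εp + Jm / 2 * εm = 0 := by
    simp only [δ, εp, εm, Jp, Jm]
    field_simp
    simp only [D]
    clear * -
    grind [Complex.I_sq]
  have h25 : Complex.I * (ε : ℂ) * εp + Jp / 2 * αm + Jm / 2 * β = -(Jp / 2) := by
    simp only [αm, β, εp, Jp, Jm]
    field_simp
    simp only [D]
    clear * -
    grind [Complex.I_sq]
  have h28 : Complex.I * (ε : ℂ) * εm + Jp / 2 * β + Jm / 2 * αp = -(Jm / 2) := by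
    simp only [αp, β, εm, Jp, Jm]
    field_simp
    simp only [D]
    clear * -
    grind [Complex.I_sq]
  have h41 : (Complex.I * (ε : ℂ) - (Jz : ℂ)) * β + Jp * εm = 0 := by
    simp only [β, εm, Jp]
    field_simp
    simp only [D]
    clear * -
    grind [Complex.I_sq]
  have h44 : (Complex.I * (ε : ℂ) - (Jz : ℂ)) * αm + Jp * εp = Complex.I * (ε : ℂ) + (Jz : ℂ) := by
    simp only [αm, εp, Jp]
    field_simp
    simp only [D]
    clear * -
    grind [Complex.I_sq]
  have h46 : (Complex.I * (ε : ℂ) - (Jz : ℂ)) * εp + Jp / 2 * (γ + δ) = -(Jp / 2) := by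
    simp only [γ, δ, εp, Jp]
    field_simp
    simp only [D]
    clear * -
    grind [Complex.I_sq]
  have hM : ((1 / 2 : ℂ) • M).IsHermitian :=
    (interactionMatrix_isHermitian Jx Jy Jz).smul (by simp [IsSelfAdjoint])
  have hS : ((Complex.I * (ε : ℂ)) • (1 : Matrix (Fin 8) (Fin 8) ℂ) + (1 / 2 : ℂ) • M) * S =
      (Complex.I * (ε : ℂ)) • (1 : Matrix (Fin 8) (Fin 8) ℂ) - (1 / 2 : ℂ) • M :=
    add_interactionMatrix_mul_scatteringMatrix h11 h14 h16 h22 h23 h25 h28 h41 h44 h46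
  have hU : Sᴴ * S = 1 := conjTranspose_mul_self_of_cayley
    (mul_ne_zero Complex.I_ne_zero (Complex.ofReal_ne_zero.mpr hε.ne')) (by simp) hM hS
  exact ⟨hD, hS, hU, mul_eq_one_comm.mp hU⟩
end

section
/- (Theorem 1) Let λ, φ, J be real with cos φ > 0, cos λ > 0, J > 0, and 1 − 2J² + cos 2φ ≠ 0. Define the 4×4 complex matrices T := (1/cos φ) · !![e^{−iλ}, −sin φ, 0, 0; −sin φ, e^{iλ}, 0, 0; 0, 0, e^{−iλ}, −sin φ; 0, 0, −sin φ, e^{iλ}] and T₀ := (1 − 2J² + cos 2φ)⁻¹ · !![2e^{−iλ}(−J² + cos φ), −sin 2φ, 2i·e^{−iλ}·J·sin φ, 2iJ(−1 + cos φ); −sin 2φ, 2e^{iλ}(J² + cos φ), −2iJ(1 + cos φ), 2i·e^{iλ}·J·sin φ; −2i·e^{−iλ}·J·sin φ, 2iJ(1 + cos φ), 2e^{−iλ}(J² + cos φ), −sin 2φ; −2iJ(−1 + cos φ), −2i·e^{iλ}·J·sin φ, −sin 2φ, 2e^{iλ}(−J² + cos φ)]. With D := cos²λ − cos²φ and √D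 := Real.sqrt D, define v₁^± := (sin φ, −i·sin λ ∓ √D, 0, 0)ᵀ and v₂^± := (0, 0, sin φ, −i·sin λ ∓ √D)ᵀ in ℂ⁴. Then the following are equivalent: (I) there exists a function Ψ : ℤ → ℂ⁴, not identically zero, satisfying Ψ(x+1) = T·Ψ(x) for every integer x ≠ 0, Ψ(1) = T₀·Ψ(0), and Σ_{x∈ℤ} ‖Ψ(x)‖² < ∞ (i.e., the function x ↦ ‖Ψ(x)‖² is summable over ℤ); (II) cos²λ > cos²φ, and there exists a nonzero vector v ∈ ℂ⁴ lying in the span of {v₁⁺, v₂⁺} such that T₀·v lies in the span of {v₁⁻, v₂⁻}. -/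
open Matrix
open Filter Topology

/-- The block-diagonal transfer matrix with two equal `2 × 2` blocks. -/
noncomputable def bulkTransfer (c s eM eP : ℂ) : Matrix (Fin 4) (Fin 4) ℂ :=
  c⁻¹ • !![eM, -s, 0, 0; -s, eP, 0, 0; 0, 0, eM, -s; 0, 0, -s, eP]

theorem bulkTransfer_mul_self {c s eM eP p q : ℂ} (hc : c ≠ 0) (hcs : c ^ 2 + s ^ 2 = 1)
    (he : eM * eP = 1) (hsum : c * (p + q) = eM + eP) :
    bulkTransfer c s eM eP * bulkTransfer c s eM eP =
      (p + q) • bulkTransfer c s eM eP - 1 := by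
  have hpq : p + q = c⁻¹ * (eM + eP) := by rw [← hsum]; field_simp
  rw [hpq]
  ext i j
  fin_cases i <;> fin_cases j <;>
    simp [bulkTransfer, Matrix.mul_apply, Fin.sum_univ_four] <;> field_simp <;>
    first | ring1 | linear_combination hcs - he

theorem bulkTransfer_mulVec_of_mem_span {c s eM eP z w : ℂ} (hc : c ≠ 0)
    (hw : w = eM - c * z) (hz : (eM - c * z) * (eP - c * z) = s ^ 2) {v : Fin 4 → ℂ}
    (hv : v ∈ Submodule.span ℂ ({![s, w, 0, 0], ![0, 0, s, w]} : Set (Fin 4 → ℂ))) :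
    bulkTransfer c s eM eP *ᵥ v = z • v := by
  obtain ⟨a, b, rfl⟩ := Submodule.mem_span_pair.1 hv
  subst hw
  ext i
  fin_cases i <;>
    simp [bulkTransfer, Matrix.mulVec, dotProduct, Fin.sum_univ_four] <;> field_simp
  · ring
  · linear_combination a * hz
  · ring
  · linear_combination b * hz

theorem mem_span_of_bulkTransfer_mulVec {c s eM eP z w : ℂ} (hc : c ≠ 0) (hs : s ≠ 0)
    (hw : w = eM - c * z) {v : Fin 4 → ℂ} (hv : bulkTransfer c s eM eP *ᵥ v = z • v) :
    v ∈ Submodule.span ℂ ({![s, w, 0, 0], ![0, 0, s, w]} : Set (Fin 4 → ℂ)) := by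
  subst hw
  have h0 := congrFun hv 0
  have h2 := congrFun hv 2
  simp [bulkTransfer, Matrix.mulVec, dotProduct, Fin.sum_univ_four] at h0 h2
  field_simp at h0 h2
  refine Submodule.mem_span_pair.2 ⟨v 0 / s, v 2 / s, ?_⟩
  ext i
  fin_cases i <;> simp <;> field_simp
  · linear_combination h0
  · linear_combination h2

section Recursion

variable {A : Matrix (Fin 4) (Fin 4) ℂ} {p q : ℂ} {f : ℕ → Fin 4 → ℂ}

theorem eq_zero_of_tendsto_of_expanding {g : ℕ → Fin 4 → ℂ} (hp : 1 ≤ ‖p‖)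
    (hg : ∀ n, g (n + 1) = p • g n) (h : Tendsto g atTop (𝓝 0)) : g 0 = 0 := by
  have hmono : ∀ n, ‖g 0‖ ≤ ‖g n‖ := by
    intro n
    induction n with
    | zero => exact le_rfl
    | succ n ih =>
      rw [hg, norm_smul]
      exact ih.trans (le_mul_of_one_le_left (norm_nonneg _) hp)
  have hlim : Tendsto (fun n => ‖g n‖) atTop (𝓝 0) := by simpa using h.norm
  exact norm_le_zero_iff.1 (ge_of_tendsto' hlim hmono)

theorem mulVec_eq_smul_of_tendsto (hA : A * A = (p + q) • A - (1 : Matrix (Fin 4) (Fin 4) ℂ))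
    (hpq : p * q = 1) (hp : 1 ≤ ‖p‖) (hf : ∀ n, f (n + 1) = A *ᵥ f n)
    (h : Tendsto f atTop (𝓝 0)) (n : ℕ) : A *ᵥ f n = q • f n := by
  have key : ∀ v, A *ᵥ (A *ᵥ v - q • v) = p • (A *ᵥ v - q • v) := by
    intro v
    rw [mulVec_sub, mulVec_smul, mulVec_mulVec, hA, sub_mulVec, smul_mulVec, one_mulVec,
      smul_sub, smul_smul, hpq, add_smul, one_smul]
    abel
  have hshift : Tendsto (fun k => f (k + n)) atTop (𝓝 0) :=
    h.comp (tendsto_add_atTop_nat n)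
  have hshift' : Tendsto (fun k => f (k + 1 + n)) atTop (𝓝 0) :=
    hshift.comp (tendsto_add_atTop_nat 1)
  have := eq_zero_of_tendsto_of_expanding (g := fun k => A *ᵥ f (k + n) - q • f (k + n)) hp
    (fun k => by
      have : f (k + 1 + n) = A *ᵥ f (k + n) := by rw [← hf]; congr 1; omega
      simp only [this]
      rw [← key, mulVec_sub, mulVec_smul])
    (by
      have h2 := hshift'.sub (hshift.const_smul q)
      simp only [smul_zero, sub_zero] at h2
      refine h2.congr fun k => ?_
      rw [← hf]; congr 2; omega)
  simpa [sub_eq_zero] using this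

theorem eq_zero_of_tendsto (hA : A * A = (p + q) • A - (1 : Matrix (Fin 4) (Fin 4) ℂ))
    (hpq : p * q = 1) (hp : 1 ≤ ‖p‖) (hq : 1 ≤ ‖q‖) (hf : ∀ n, f (n + 1) = A *ᵥ f n)
    (h : Tendsto f atTop (𝓝 0)) : f 0 = 0 :=
  eq_zero_of_tendsto_of_expanding hq
    (fun n => (hf n).trans (mulVec_eq_smul_of_tendsto hA hpq hp hf h n)) h

theorem eq_zero_of_recursion (hf : ∀ n, f (n + 1) = A *ᵥ f n) (h0 : f 0 = 0) (n : ℕ) :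
    f n = 0 := by
  induction n with
  | zero => exact h0
  | succ n ih => rw [hf, ih, mulVec_zero]

end Recursion

section Impurity

variable {T T₀ : Matrix (Fin 4) (Fin 4) ℂ} {p q : ℂ} {Ψ : ℤ → Fin 4 → ℂ}

theorem trace_sub_mul_self (hT : T * T = (p + q) • T - 1) :
    ((p + q) • (1 : Matrix (Fin 4) (Fin 4) ℂ) - T) * ((p + q) • 1 - T) =
      (p + q) • ((p + q) • 1 - T) - 1 := by
  rw [sub_mul, mul_sub, mul_sub, hT]
  simp only [smul_mul_assoc, mul_smul_comm, one_mul, mul_one, smul_sub]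
  abel

theorem right_recursion (h : ∀ x : ℤ, x ≠ 0 → Ψ (x + 1) = T *ᵥ Ψ x) (n : ℕ) :
    Ψ (((n + 1 : ℕ) : ℤ) + 1) = T *ᵥ Ψ ((n : ℤ) + 1) := by
  rw [h _ (by omega)]; push_cast; rfl

theorem left_recursion (hT : T * T = (p + q) • T - 1)
    (h : ∀ x : ℤ, x ≠ 0 → Ψ (x + 1) = T *ᵥ Ψ x) (n : ℕ) :
    Ψ (-((n + 1 : ℕ) : ℤ)) = ((p + q) • (1 : Matrix (Fin 4) (Fin 4) ℂ) - T) *ᵥ Ψ (-(n : ℤ)) := by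
  have h1 := h (-((n + 1 : ℕ) : ℤ)) (by omega)
  have h2 : -((n + 1 : ℕ) : ℤ) + 1 = -(n : ℤ) := by push_cast; ring
  rw [h2] at h1
  rw [h1, mulVec_mulVec, sub_mul, hT, smul_mul_assoc, one_mul, sub_sub_cancel, one_mulVec]

theorem tendsto_zero_of_summable (h : Summable fun x : ℤ => ∑ i : Fin 4, ‖Ψ x i‖ ^ 2)
    {u : ℕ → ℤ} (hu : Function.Injective u) : Tendsto (fun n => Ψ (u n)) atTop (𝓝 0) := by
  rw [tendsto_pi_nhds]
  intro i
  have h1 : Summable fun x : ℤ => ‖Ψ x i‖ ^ 2 :=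
    h.of_nonneg_of_le (fun _ => by positivity) fun x =>
      Finset.single_le_sum (f := fun j => ‖Ψ x j‖ ^ 2) (fun _ _ => by positivity)
        (Finset.mem_univ i)
  have h2 := ((h1.comp_injective hu).tendsto_atTop_zero).sqrt
  rw [Pi.zero_apply, tendsto_zero_iff_norm_tendsto_zero]
  simpa using h2

theorem right_injective : Function.Injective fun n : ℕ => (n : ℤ) + 1 :=
  fun a b h => by simpa using h

theorem left_injective : Function.Injective fun n : ℕ => -(n : ℤ) :=
  fun a b h => by simpa using h

theorem eq_zero_of_left_eq_zero (hT : T * T = (p + q) • T - 1)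
    (h : ∀ x : ℤ, x ≠ 0 → Ψ (x + 1) = T *ᵥ Ψ x) (h₀ : Ψ 1 = T₀ *ᵥ Ψ 0) (h0 : Ψ 0 = 0) :
    Ψ = 0 := by
  have hr := eq_zero_of_recursion (f := fun n : ℕ => Ψ ((n : ℤ) + 1)) (right_recursion h)
    (by simp [h₀, h0])
  have hl := eq_zero_of_recursion (f := fun n : ℕ => Ψ (-(n : ℤ))) (left_recursion hT h)
    (by simp [h0])
  funext x
  rcases le_or_gt x 0 with hx | hx
  · have := hl (-x).toNat
    rwa [show -(((-x).toNat : ℕ) : ℤ) = x by omega] at this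
  · have := hr (x - 1).toNat
    rwa [show (((x - 1).toNat : ℕ) : ℤ) + 1 = x by omega] at this

theorem mulVec_eq_smul_of_summable (hT : T * T = (p + q) • T - 1) (hpq : p * q = 1)
    (hp : 1 ≤ ‖p‖) (h : ∀ x : ℤ, x ≠ 0 → Ψ (x + 1) = T *ᵥ Ψ x)
    (hs : Summable fun x : ℤ => ∑ i : Fin 4, ‖Ψ x i‖ ^ 2) :
    T *ᵥ Ψ 0 = p • Ψ 0 ∧ T *ᵥ Ψ 1 = q • Ψ 1 := by
  constructor
  · have := mulVec_eq_smul_of_tendsto (f := fun n : ℕ => Ψ (-(n : ℤ)))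
      (trace_sub_mul_self hT) hpq hp (left_recursion hT h)
      (tendsto_zero_of_summable hs left_injective) 0
    simp only [Nat.cast_zero, neg_zero, sub_mulVec, smul_mulVec, one_mulVec] at this
    rw [add_smul, sub_eq_iff_eq_add', add_left_inj] at this
    exact this.symm
  · simpa using mulVec_eq_smul_of_tendsto (f := fun n : ℕ => Ψ ((n : ℤ) + 1)) hT hpq hp
      (right_recursion h) (tendsto_zero_of_summable hs right_injective) 0

theorem eq_zero_of_summable (hT : T * T = (p + q) • T - 1) (hpq : p * q = 1)
    (hp : 1 ≤ ‖p‖) (hq : 1 ≤ ‖q‖) (h : ∀ x : ℤ, x ≠ 0 → Ψ (x + 1) = T *ᵥ Ψ x)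
    (h₀ : Ψ 1 = T₀ *ᵥ Ψ 0) (hs : Summable fun x : ℤ => ∑ i : Fin 4, ‖Ψ x i‖ ^ 2) : Ψ = 0 :=
  eq_zero_of_left_eq_zero hT h h₀ <| by
    simpa using eq_zero_of_tendsto (f := fun n : ℕ => Ψ (-(n : ℤ)))
      (trace_sub_mul_self hT) hpq hp hq (left_recursion hT h)
      (tendsto_zero_of_summable hs left_injective)

theorem exists_summable_of_eigenvectors (hpq : p * q = 1) (hq : ‖q‖ < 1) {v : Fin 4 → ℂ}
    (hv : v ≠ 0) (hTv : T *ᵥ v = p • v) (hTw : T *ᵥ (T₀ *ᵥ v) = q • (T₀ *ᵥ v)) :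
    ∃ Ψ : ℤ → Fin 4 → ℂ, Ψ ≠ 0 ∧ (∀ x : ℤ, x ≠ 0 → Ψ (x + 1) = T *ᵥ Ψ x) ∧
      Ψ 1 = T₀ *ᵥ Ψ 0 ∧ (Summable fun x : ℤ => ∑ i : Fin 4, ‖Ψ x i‖ ^ 2) := by
  have hgeom : ∀ u : Fin 4 → ℂ, Summable fun n : ℕ => ∑ i : Fin 4, ‖(q ^ n • u) i‖ ^ 2 := by
    intro u
    have hg : Summable fun n : ℕ => (‖q‖ ^ 2) ^ n :=
      summable_geometric_of_lt_one (by positivity) (by nlinarith [norm_nonneg q])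
    refine (hg.mul_right (∑ i : Fin 4, ‖u i‖ ^ 2)).congr fun n => ?_
    rw [Finset.mul_sum]
    refine Finset.sum_congr rfl fun i _ => ?_
    rw [Pi.smul_apply, norm_smul, norm_pow]
    ring
  refine ⟨fun x => if x ≤ 0 then q ^ (-x).toNat • v else q ^ (x - 1).toNat • (T₀ *ᵥ v),
    fun h => hv (by simpa using congrFun h 0), fun x hx => ?_, by simp, ?_⟩
  · rcases lt_or_gt_of_ne hx with hx | hx
    · have h1 : (-x).toNat = (-(x + 1)).toNat + 1 := by omega
      simp only [if_pos (show x + 1 ≤ 0 by omega), if_pos hx.le]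
      rw [h1, mulVec_smul, hTv, smul_smul, pow_succ, mul_assoc, mul_comm q p, hpq, mul_one]
    · have h1 : (x + 1 - 1).toNat = (x - 1).toNat + 1 := by omega
      simp only [if_neg (show ¬ x + 1 ≤ 0 by omega), if_neg (show ¬ x ≤ 0 by omega)]
      rw [h1, mulVec_smul, hTw, smul_smul, pow_succ]
  · refine Summable.of_nat_of_neg_add_one ?_ ?_
    · refine (summable_nat_add_iff 1).1 ((hgeom (T₀ *ᵥ v)).congr fun n => ?_)
      beta_reduce
      rw [if_neg (by omega), show (((n + 1 : ℕ) : ℤ) - 1).toNat = n by omega]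
    · refine ((summable_nat_add_iff 1).2 (hgeom v)).congr fun n => ?_
      beta_reduce
      rw [if_pos (by omega), show (-(-((n : ℤ) + 1))).toNat = n + 1 by omega]

end Impurity

theorem stmt_19 (lam φ J : ℝ) (hφ : 0 < Real.cos φ) (hlam : 0 < Real.cos lam)
    (hJ : 0 < J) (hden : 1 - 2 * J ^ 2 + Real.cos (2 * φ) ≠ 0) :
    let eP : ℂ := Complex.exp (Complex.I * (lam : ℂ))
    let eM : ℂ := Complex.exp (-(Complex.I * (lam : ℂ)))
    let T : Matrix (Fin 4) (Fin 4) ℂ :=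
      ((Real.cos φ : ℂ))⁻¹ •
        !![eM, -(Real.sin φ : ℂ), 0, 0;
           -(Real.sin φ : ℂ), eP, 0, 0;
           0, 0, eM, -(Real.sin φ : ℂ);
           0, 0, -(Real.sin φ : ℂ), eP]
    let T₀ : Matrix (Fin 4) (Fin 4) ℂ :=
      (((1 - 2 * J ^ 2 + Real.cos (2 * φ) : ℝ) : ℂ))⁻¹ •
        !![2 * eM * (-(J : ℂ) ^ 2 + (Real.cos φ : ℂ)), -(Real.sin (2 * φ) : ℂ),
             2 * Complex.I * eM * (J : ℂ) * (Real.sin φ : ℂ),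
             2 * Complex.I * (J : ℂ) * (-1 + (Real.cos φ : ℂ));
           -(Real.sin (2 * φ) : ℂ), 2 * eP * ((J : ℂ) ^ 2 + (Real.cos φ : ℂ)),
             -(2 * Complex.I * (J : ℂ) * (1 + (Real.cos φ : ℂ))),
             2 * Complex.I * eP * (J : ℂ) * (Real.sin φ : ℂ);
           -(2 * Complex.I * eM * (J : ℂ) * (Real.sin φ : ℂ)),
             2 * Complex.I * (J : ℂ) * (1 + (Real.cos φ : ℂ)),
             2 * eM * ((J : ℂ) ^ 2 + (Real.cos φ : ℂ)), -(Real.sin (2 * φ) : ℂ);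
           -(2 * Complex.I * (J : ℂ) * (-1 + (Real.cos φ : ℂ))),
             -(2 * Complex.I * eP * (J : ℂ) * (Real.sin φ : ℂ)),
             -(Real.sin (2 * φ) : ℂ), 2 * eP * (-(J : ℂ) ^ 2 + (Real.cos φ : ℂ))]
    let D : ℝ := Real.cos lam ^ 2 - Real.cos φ ^ 2
    let v₁p : Fin 4 → ℂ :=
      ![(Real.sin φ : ℂ), -Complex.I * (Real.sin lam : ℂ) - (Real.sqrt D : ℂ), 0, 0]
    let v₁m : Fin 4 → ℂ :=
      ![(Real.sin φ : ℂ), -Complex.I * (Real.sin lam : ℂ) + (Real.sqrt D : ℂ), 0, 0]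
    let v₂p : Fin 4 → ℂ :=
      ![0, 0, (Real.sin φ : ℂ), -Complex.I * (Real.sin lam : ℂ) - (Real.sqrt D : ℂ)]
    let v₂m : Fin 4 → ℂ :=
      ![0, 0, (Real.sin φ : ℂ), -Complex.I * (Real.sin lam : ℂ) + (Real.sqrt D : ℂ)]
    ((∃ Ψ : ℤ → Fin 4 → ℂ, Ψ ≠ 0 ∧
        (∀ x : ℤ, x ≠ 0 → Ψ (x + 1) = T *ᵥ Ψ x) ∧
        Ψ 1 = T₀ *ᵥ Ψ 0 ∧
        (Summable fun x : ℤ => ∑ i : Fin 4, ‖Ψ x i‖ ^ 2)) ↔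
      (Real.cos φ ^ 2 < Real.cos lam ^ 2 ∧
        ∃ v : Fin 4 → ℂ, v ≠ 0 ∧
          v ∈ Submodule.span ℂ ({v₁p, v₂p} : Set (Fin 4 → ℂ)) ∧
          T₀ *ᵥ v ∈ Submodule.span ℂ ({v₁m, v₂m} : Set (Fin 4 → ℂ)))) := by
  intro eP eM T T₀ D v₁p v₁m v₂p v₂m
  set C : ℂ := (Real.cos lam : ℂ) with hC
  set L : ℂ := (Real.sin lam : ℂ) with hL
  set c : ℂ := (Real.cos φ : ℂ) with hcdef
  set s : ℂ := (Real.sin φ : ℂ) with hsdef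
  have hc : c ≠ 0 := Complex.ofReal_ne_zero.2 hφ.ne'
  have hCL : C ^ 2 + L ^ 2 = 1 := by
    rw [hC, hL]; exact_mod_cast Real.cos_sq_add_sin_sq lam
  have hcs : c ^ 2 + s ^ 2 = 1 := by
    rw [hcdef, hsdef]; exact_mod_cast Real.cos_sq_add_sin_sq φ
  have heP : eP = C + Complex.I * L := by
    simp only [eP, hC, hL, Complex.ofReal_cos, Complex.ofReal_sin]
    rw [mul_comm, Complex.exp_mul_I]; ring
  have heM : eM = C - Complex.I * L := by
    simp only [eM, hC, hL, Complex.ofReal_cos, Complex.ofReal_sin]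
    rw [mul_comm, ← neg_mul, Complex.exp_mul_I, Complex.cos_neg, Complex.sin_neg]; ring
  have heMP : eM * eP = 1 := by
    rw [heP, heM]; linear_combination hCL - L ^ 2 * Complex.I_sq
  have hTdef : T = bulkTransfer c s eM eP := rfl
  have hquad : ∀ r : ℂ, T * T = ((C + r) / c + (C - r) / c) • T - 1 := fun r => by
    rw [hTdef]
    refine bulkTransfer_mul_self hc hcs heMP ?_
    rw [heP, heM]; field_simp; ring
  have hprod : ∀ r : ℂ, r ^ 2 = C ^ 2 - c ^ 2 → (C + r) / c * ((C - r) / c) = 1 := by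
    intro r hr; field_simp; linear_combination -hr
  rcases le_or_gt (Real.cos lam ^ 2) (Real.cos φ ^ 2) with hD | hD
  · refine iff_of_false ?_ fun h => hD.not_gt h.1
    rintro ⟨Ψ, hne, hrec, h₀, hsum⟩
    have hr : (Real.sqrt (Real.cos φ ^ 2 - Real.cos lam ^ 2)) ^ 2 =
        Real.cos φ ^ 2 - Real.cos lam ^ 2 := Real.sq_sqrt (sub_nonneg.2 hD)
    set ρ := Real.sqrt (Real.cos φ ^ 2 - Real.cos lam ^ 2)
    have hnorm : ∀ t : ℝ, t ^ 2 = ρ ^ 2 → 1 ≤ ‖(C + (t : ℂ) * Complex.I) / c‖ := by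
      intro t ht
      rw [hC, hcdef, norm_div, Complex.norm_add_mul_I, ht, hr, add_sub_cancel,
        Real.sqrt_sq hφ.le, Complex.norm_real, Real.norm_of_nonneg hφ.le, div_self hφ.ne']
    refine hne (eq_zero_of_summable (hquad ((ρ : ℂ) * Complex.I)) (hprod _ ?_) (hnorm ρ rfl) ?_
      hrec h₀ hsum)
    · have : (ρ : ℂ) ^ 2 = c ^ 2 - C ^ 2 := by rw [hC, hcdef]; exact_mod_cast hr
      rw [mul_pow, this, Complex.I_sq]; ring
    · simpa [sub_eq_add_neg] using hnorm (-ρ) (neg_sq ρ)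
  · have hr : (Real.sqrt D) ^ 2 = D := Real.sq_sqrt (sub_nonneg.2 hD.le)
    have hrpos : 0 < Real.sqrt D := Real.sqrt_pos.2 (sub_pos.2 hD)
    have hrD : Real.sqrt D ^ 2 = Real.cos lam ^ 2 - Real.cos φ ^ 2 := hr
    set ρ := Real.sqrt D
    have hρ : (ρ : ℂ) ^ 2 = C ^ 2 - c ^ 2 := by rw [hC, hcdef]; exact_mod_cast hrD
    have hs : s ≠ 0 := by
      refine Complex.ofReal_ne_zero.2 fun h => ?_
      nlinarith [Real.sin_sq_add_cos_sq φ, Real.sin_sq_add_cos_sq lam, sq_nonneg (Real.sin lam)]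
    have hlt : Real.cos φ < Real.cos lam := lt_of_pow_lt_pow_left₀ 2 hlam.le hD
    have hp : 1 ≤ ‖(C + (ρ : ℂ)) / c‖ := by
      rw [hC, hcdef, ← Complex.ofReal_add, ← Complex.ofReal_div, Complex.norm_real,
        Real.norm_of_nonneg (by positivity), one_le_div hφ]
      linarith
    have hq : ‖(C - (ρ : ℂ)) / c‖ < 1 := by
      have hρlt : ρ < Real.cos lam := by nlinarith
      rw [hC, hcdef, ← Complex.ofReal_sub, ← Complex.ofReal_div, Complex.norm_real,
        Real.norm_of_nonneg (div_nonneg (by linarith) hφ.le), div_lt_one hφ]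
      nlinarith
    have hpq := hprod ρ hρ
    have hwp : -Complex.I * L - (ρ : ℂ) = eM - c * ((C + ρ) / c) := by
      rw [heM]; field_simp; ring
    have hwm : -Complex.I * L + (ρ : ℂ) = eM - c * ((C - ρ) / c) := by
      rw [heM]; field_simp; ring
    constructor
    · rintro ⟨Ψ, hne, hrec, h₀, hsum⟩
      obtain ⟨hl, hr'⟩ := mulVec_eq_smul_of_summable (hquad ρ) hpq hp hrec hsum
      refine ⟨hD, Ψ 0, fun h => hne (eq_zero_of_left_eq_zero (hquad ρ) hrec h₀ h),
        mem_span_of_bulkTransfer_mulVec hc hs hwp hl, ?_⟩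
      rw [← h₀]
      exact mem_span_of_bulkTransfer_mulVec hc hs hwm hr'
    · rintro ⟨-, v, hv, hvp, hvm⟩
      have hchar : ∀ t : ℂ, t ^ 2 = C ^ 2 - c ^ 2 → ∀ z, c * z = C + t →
          (eM - c * z) * (eP - c * z) = s ^ 2 := by
        intro t ht z hz
        rw [hz, heM, heP]
        linear_combination ht - L ^ 2 * Complex.I_sq + hCL - hcs
      refine exists_summable_of_eigenvectors hpq hq hv
        (bulkTransfer_mulVec_of_mem_span hc hwp (hchar ρ hρ _ ?_) hvp)
        (bulkTransfer_mulVec_of_mem_span hc hwm (hchar (-ρ) ?_ _ ?_) hvm)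
      · field_simp
      · rw [neg_sq, hρ]
      · field_simp; ring
end
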